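/- Let p, q, r ≥ 1. The function ‖T‖_# := ((P₁(T) + P₂(T) + P₃(T) + 2P₄(T))/5)^{1/4} is a norm on the space of 3-way tensors T : Fin p → Fin q → Fin r → ℝ: the quantity P₁(T) + P₂(T) + P₃(T) + 2P₄(T) is nonnegative for every T; ‖T‖_# = 0 if and only if T = 0; ‖λ•T‖_# = |λ|·‖T‖_# for all λ ∈ ℝ; and ‖T + S‖_# ≤ ‖T‖_# + ‖S‖_# for all tensors T, S. -/

import Mathlib

noncomputable def P₁ {p q r : ℕ} (T : Fin p → Fin q → Fin r → ℝ) : ℝ :=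
  ∑ a, ∑ b, ∑ c, ∑ d, ∑ e, ∑ f, T a c e * T a d f * T b c e * T b d f

noncomputable def P₂ {p q r : ℕ} (T : Fin p → Fin q → Fin r → ℝ) : ℝ :=
  ∑ a, ∑ b, ∑ c, ∑ d, ∑ e, ∑ f, T a c e * T a d e * T b c f * T b d f

noncomputable def P₃ {p q r : ℕ} (T : Fin p → Fin q → Fin r → ℝ) : ℝ :=
  ∑ a, ∑ b, ∑ c, ∑ d, ∑ e, ∑ f, T a c e * T a c f * T b d e * T b d f

/-- The tetrahedron invariant. -/
noncomputable def P₄ {p q r : ℕ} (T : Fin p → Fin q → Fin r → ℝ) : ℝ :=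
  ∑ a, ∑ b, ∑ c, ∑ d, ∑ e, ∑ f, T a c e * T a d f * T b d e * T b c f

/-- The degree-4 spectral-norm approximation `‖T‖_#`. -/
noncomputable def sharpNorm {p q r : ℕ} (T : Fin p → Fin q → Fin r → ℝ) : ℝ :=
  ((P₁ T + P₂ T + P₃ T + 2 * P₄ T) / 5) ^ ((4 : ℝ)⁻¹)

/-- The sum over all six indices occurring in a degree-4 invariant. -/
def sumSix {A C E : Type*} [Fintype A] [Fintype C] [Fintype E]
    (φ : A → A → C → C → E → E → ℝ) : ℝ :=
  ∑ a, ∑ b, ∑ c, ∑ d, ∑ e, ∑ f, φ a b c d e f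

section SumSix

variable {A C E : Type*} [Fintype A] [Fintype C] [Fintype E]

theorem sumSix_congr {φ ψ : A → A → C → C → E → E → ℝ}
    (h : ∀ a b c d e f, φ a b c d e f = ψ a b c d e f) : sumSix φ = sumSix ψ := by
  simp only [sumSix, h]

theorem sumSix_add (φ ψ : A → A → C → C → E → E → ℝ) :
    sumSix φ + sumSix ψ = sumSix fun a b c d e f => φ a b c d e f + ψ a b c d e f := by
  simp only [sumSix, Finset.sum_add_distrib]

theorem mul_sumSix (x : ℝ) (φ : A → A → C → C → E → E → ℝ) :
    x * sumSix φ = sumSix fun a b c d e f => x * φ a b c d e f := by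
  simp only [sumSix, Finset.mul_sum]

theorem sumSix_swap_fst (φ : A → A → C → C → E → E → ℝ) :
    (sumSix fun a b c d e f => φ b a c d e f) = sumSix φ :=
  Finset.sum_comm

theorem sumSix_swap_snd (φ : A → A → C → C → E → E → ℝ) :
    (sumSix fun a b c d e f => φ a b d c e f) = sumSix φ :=
  Finset.sum_congr rfl fun _ _ => Finset.sum_congr rfl fun _ _ => Finset.sum_comm

theorem sumSix_swap_thd (φ : A → A → C → C → E → E → ℝ) :
    (sumSix fun a b c d e f => φ a b c d f e) = sumSix φ :=
  Finset.sum_congr rfl fun _ _ => Finset.sum_congr rfl fun _ _ =>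
    Finset.sum_congr rfl fun _ _ => Finset.sum_congr rfl fun _ _ => Finset.sum_comm

theorem eight_mul_sumSix (φ : A → A → C → C → E → E → ℝ) :
    8 * sumSix φ = sumSix fun a b c d e f =>
      φ a b c d e f + φ b a c d e f + φ a b d c e f + φ b a d c e f +
      φ a b c d f e + φ b a c d f e + φ a b d c f e + φ b a d c f e := by
  simp only [← sumSix_add]
  rw [sumSix_swap_fst φ, sumSix_swap_snd φ, sumSix_swap_thd φ,
    sumSix_swap_fst (fun a b c d e f => φ a b d c e f), sumSix_swap_snd φ,
    sumSix_swap_fst (fun a b c d e f => φ a b c d f e), sumSix_swap_thd φ,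
    sumSix_swap_snd (fun a b c d e f => φ a b c d f e), sumSix_swap_thd φ,
    sumSix_swap_fst (fun a b c d e f => φ a b d c f e),
    sumSix_swap_snd (fun a b c d e f => φ a b c d f e), sumSix_swap_thd φ]
  ring

/-- Two six-fold sums agree if the symmetrizations of their summands agree. -/
theorem sumSix_eq_of_symm {φ ψ : A → A → C → C → E → E → ℝ}
    (h : ∀ a b c d e f,
      φ a b c d e f + φ b a c d e f + φ a b d c e f + φ b a d c e f +
      φ a b c d f e + φ b a c d f e + φ a b d c f e + φ b a d c f e =
      ψ a b c d e f + ψ b a c d e f + ψ a b d c e f + ψ b a d c e f +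
      ψ a b c d f e + ψ b a c d f e + ψ a b d c f e + ψ b a d c f e) :
    sumSix φ = sumSix ψ := by
  have : 8 * sumSix φ = 8 * sumSix ψ := by
    rw [eight_mul_sumSix φ, eight_mul_sumSix ψ]
    simp only [h]
  linarith

theorem sum_pair_comm (φ : A → A → C → C → ℝ) :
    ∑ a, ∑ b, ∑ c, ∑ d, φ a b c d = ∑ c, ∑ d, ∑ a, ∑ b, φ a b c d := by
  have := Finset.sum_comm (s := Finset.univ) (t := Finset.univ)
    (f := fun (x : A × A) (y : C × C) => φ x.1 x.2 y.1 y.2)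
  simpa only [Fintype.sum_prod_type] using this

theorem sumSix_rotate_snd (φ : A → A → C → C → E → E → ℝ) :
    sumSix φ = sumSix fun c d a b e f => φ a b c d e f :=
  sum_pair_comm _

theorem sumSix_swap_last (φ : A → A → C → C → E → E → ℝ) :
    sumSix φ = sumSix fun a b e f c d => φ a b c d e f :=
  Finset.sum_congr rfl fun _ _ => Finset.sum_congr rfl fun _ _ => sum_pair_comm _

theorem sumSix_rotate_thd (φ : A → A → C → C → E → E → ℝ) :
    sumSix φ = sumSix fun e f a b c d => φ a b c d e f := by
  rw [sumSix_swap_last, sumSix_rotate_snd]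

theorem sumSix_mul_self (k : A → C → C → E → E → ℝ) :
    (sumSix fun a b c d e f => k a c d e f * k b c d e f) =
      ∑ c, ∑ d, ∑ e, ∑ f, (∑ a, k a c d e f) ^ 2 := by
  rw [sumSix_rotate_snd, sumSix_swap_last]
  simp only [sumSix, sq, Finset.sum_mul_sum]

theorem sumSix_pairing (g : A → A → C → E → ℝ) :
    (sumSix fun a b c d e f => g a b c e * g a b d f) =
      ∑ a, ∑ b, (∑ c, ∑ e, g a b c e) ^ 2 := by
  refine Finset.sum_congr rfl fun a _ => Finset.sum_congr rfl fun b _ => ?_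
  simp only [sq, Finset.sum_mul_sum]

theorem sumSix_mul_symm_nonneg (k : A → C → C → E → E → ℝ) :
    0 ≤ sumSix fun a b c d e f =>
      k a c d e f * (k b c d e f + k b d c e f + k b c d f e + k b d c f e) := by
  have h : 4 * (sumSix fun a b c d e f =>
      k a c d e f * (k b c d e f + k b d c e f + k b c d f e + k b d c f e)) =
      ∑ c, ∑ d, ∑ e, ∑ f,
        (∑ a, (k a c d e f + k a d c e f + k a c d f e + k a d c f e)) ^ 2 := by
    rw [← sumSix_mul_self, mul_sumSix]
    exact sumSix_eq_of_symm fun a b c d e f => by ring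
  have : 0 ≤ ∑ c, ∑ d, ∑ e, ∑ f,
      (∑ a, (k a c d e f + k a d c e f + k a c d f e + k a d c f e)) ^ 2 := by positivity
  linarith

end SumSix

section SharpForm

variable {p q r : ℕ}

/-- The summand of the 4-linear form whose diagonal is `P₁ + P₂ + P₃ + 2 P₄`. -/
def sharpTerm (X Y Z W : Fin p → Fin q → Fin r → ℝ)
    (a b : Fin p) (c d : Fin q) (e f : Fin r) : ℝ :=
  X a c e * Y a d f * Z b c e * W b d f + X a c e * Y a d e * Z b c f * W b d f +
  X a c e * Y a c f * Z b d e * W b d f + 2 * (X a c e * Y a d f * Z b d e * W b c f)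

/-- The quartic form `P₁ + P₂ + P₃ + 2 P₄`. -/
def sharpQuartic (T : Fin p → Fin q → Fin r → ℝ) : ℝ :=
  sumSix (sharpTerm T T T T)

/-- The derivative of `sharpQuartic` at `T` in direction `R`. -/
def sharpDeriv (T R : Fin p → Fin q → Fin r → ℝ) : ℝ :=
  sumSix fun a b c d e f =>
    sharpTerm R T T T a b c d e f + sharpTerm T R T T a b c d e f +
    sharpTerm T T R T a b c d e f + sharpTerm T T T R a b c d e f

/-- Half the second derivative of `sharpQuartic` at `T` in direction `R`. -/
def sharpHess (T R : Fin p → Fin q → Fin r → ℝ) : ℝ :=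
  sumSix fun a b c d e f =>
    sharpTerm R R T T a b c d e f + sharpTerm R T R T a b c d e f +
    sharpTerm R T T R a b c d e f + sharpTerm T R R T a b c d e f +
    sharpTerm T R T R a b c d e f + sharpTerm T T R R a b c d e f

theorem sharpQuartic_eq (T : Fin p → Fin q → Fin r → ℝ) :
    P₁ T + P₂ T + P₃ T + 2 * P₄ T = sharpQuartic T := by
  have h₁ : P₁ T = sumSix fun a b c d e f => T a c e * T a d f * T b c e * T b d f := rfl
  have h₂ : P₂ T = sumSix fun a b c d e f => T a c e * T a d e * T b c f * T b d f := rfl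
  have h₃ : P₃ T = sumSix fun a b c d e f => T a c e * T a c f * T b d e * T b d f := rfl
  have h₄ : P₄ T = sumSix fun a b c d e f => T a c e * T a d f * T b d e * T b c f := rfl
  rw [h₁, h₂, h₃, h₄, mul_sumSix, sumSix_add, sumSix_add, sumSix_add]
  rfl

theorem sharpDeriv_add (T R S : Fin p → Fin q → Fin r → ℝ) :
    sharpDeriv T (R + S) = sharpDeriv T R + sharpDeriv T S := by
  simp only [sharpDeriv, sumSix_add]
  refine sumSix_congr fun a b c d e f => ?_
  simp only [sharpTerm, Pi.add_apply]
  ring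

theorem sharpDeriv_smul (l : ℝ) (T R : Fin p → Fin q → Fin r → ℝ) :
    sharpDeriv T (l • R) = l * sharpDeriv T R := by
  simp only [sharpDeriv, mul_sumSix]
  refine sumSix_congr fun a b c d e f => ?_
  simp only [sharpTerm, Pi.smul_apply, smul_eq_mul]
  ring

theorem sharpDeriv_self (T : Fin p → Fin q → Fin r → ℝ) :
    sharpDeriv T T = 4 * sharpQuartic T := by
  simp only [sharpDeriv, sharpQuartic, mul_sumSix]
  refine sumSix_congr fun a b c d e f => ?_
  ring

theorem sharpHess_self (T : Fin p → Fin q → Fin r → ℝ) :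
    sharpHess T T = 6 * sharpQuartic T := by
  simp only [sharpHess, sharpQuartic, mul_sumSix]
  refine sumSix_congr fun a b c d e f => ?_
  ring

theorem sharpQuartic_smul (l : ℝ) (T : Fin p → Fin q → Fin r → ℝ) :
    sharpQuartic (l • T) = l ^ 4 * sharpQuartic T := by
  simp only [sharpQuartic, mul_sumSix]
  refine sumSix_congr fun a b c d e f => ?_
  simp only [sharpTerm, Pi.smul_apply, smul_eq_mul]
  ring

theorem sharpQuartic_add (T R : Fin p → Fin q → Fin r → ℝ) :
    sharpQuartic (T + R) = sharpQuartic T + sharpDeriv T R +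
      sharpHess (T + (1 / 3 : ℝ) • R) R + 1 / 3 * sharpQuartic R := by
  simp only [sharpDeriv, sharpHess, sharpQuartic, mul_sumSix, sumSix_add]
  refine sumSix_congr fun a b c d e f => ?_
  simp only [sharpTerm, Pi.add_apply, Pi.smul_apply, smul_eq_mul]
  ring

/-- The second derivative is a sum of squares, one of which is the displayed lower bound. -/
theorem sum_sq_le_sharpHess (T S : Fin p → Fin q → Fin r → ℝ) :
    2 * ∑ a, ∑ b, (∑ c, ∑ e, T a c e * S b c e) ^ 2 ≤ sharpHess T S := by
  have e₁ := sumSix_mul_symm_nonneg fun a c d e f => T a c e * S a d f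
  have e₂ := sumSix_mul_symm_nonneg fun c a b e f => T a c e * S b c f
  have e₃ := sumSix_mul_symm_nonneg fun e a b c d => T a c e * S b d e
  rw [sumSix_rotate_snd] at e₂
  rw [← sumSix_rotate_thd fun a b c d e f => T a c e * S b d e *
    (T a c f * S b d f + T b c f * S a d f + T a d f * S b c f + T b d f * S a c f)] at e₃
  have g₁ := sumSix_pairing fun a b c e => T a c e * S b c e
  have g₂ := sumSix_pairing fun c d a e => T a c e * S a d e
  have g₃ := sumSix_pairing fun e f a c => T a c e * S a c f
  rw [sumSix_rotate_snd] at g₂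
  rw [← sumSix_rotate_thd fun a b c d e f => T a c e * S a c f * (T b d e * S b d f)] at g₃
  have n₂ : 0 ≤ ∑ c, ∑ d, (∑ a, ∑ e, T a c e * S a d e) ^ 2 := by positivity
  have n₃ : 0 ≤ ∑ e, ∑ f, (∑ a, ∑ c, T a c e * S a c f) ^ 2 := by positivity
  rw [← g₂] at n₂
  rw [← g₃] at n₃
  rw [← g₁]
  have key : sharpHess T S = 2 * (sumSix fun a b c d e f =>
      T a c e * S a d f * (T b c e * S b d f + T b d e * S b c f + T b c f * S b d e +
        T b d f * S b c e)) + 2 * (sumSix fun a b c d e f =>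
      T a c e * S b c f * (T a d e * S b d f + T b d e * S a d f + T a d f * S b d e +
        T b d f * S a d e)) + 2 * (sumSix fun a b c d e f =>
      T a c e * S b d e * (T a c f * S b d f + T b c f * S a d f + T a d f * S b c f +
        T b d f * S a c f)) +
      2 * (sumSix fun a b c d e f => T a c e * S b c e * (T a d f * S b d f)) +
      2 * (sumSix fun a b c d e f => T a c e * S a d e * (T b c f * S b d f)) +
      2 * (sumSix fun a b c d e f => T a c e * S a c f * (T b d e * S b d f)) := by
    simp only [sharpHess, mul_sumSix, sumSix_add]
    refine sumSix_eq_of_symm fun a b c d e f => ?_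
    simp only [sharpTerm]
    ring
  linarith

theorem sharpHess_nonneg (T S : Fin p → Fin q → Fin r → ℝ) : 0 ≤ sharpHess T S :=
  le_trans (by positivity) (sum_sq_le_sharpHess T S)

theorem sharpQuartic_nonneg (T : Fin p → Fin q → Fin r → ℝ) : 0 ≤ sharpQuartic T := by
  linarith [sharpHess_nonneg T T, sharpHess_self T]

theorem sharpQuartic_eq_zero_iff {T : Fin p → Fin q → Fin r → ℝ} :
    sharpQuartic T = 0 ↔ T = 0 := by
  refine ⟨fun h => ?_, fun h => by simp [h, sharpQuartic, sharpTerm, sumSix]⟩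
  have hle := sum_sq_le_sharpHess T T
  rw [sharpHess_self, h] at hle
  funext a c e
  have hle' : (∑ c, ∑ e, T a c e * T a c e) ^ 2 ≤
      ∑ a, ∑ b, (∑ c, ∑ e, T a c e * T b c e) ^ 2 :=
    (Finset.single_le_sum (f := fun b => (∑ c, ∑ e, T a c e * T b c e) ^ 2)
      (fun b _ => sq_nonneg _) (Finset.mem_univ a)).trans
    (Finset.single_le_sum (f := fun a => ∑ b, (∑ c, ∑ e, T a c e * T b c e) ^ 2)
      (fun a _ => Finset.sum_nonneg fun b _ => sq_nonneg _) (Finset.mem_univ a))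
  have hz : ∑ c, ∑ e, T a c e * T a c e = 0 :=
    pow_eq_zero_iff two_ne_zero |>.1 (le_antisymm (by linarith) (sq_nonneg _))
  have hc := (Finset.sum_eq_zero_iff_of_nonneg fun c _ =>
    Finset.sum_nonneg fun e _ => mul_self_nonneg (T a c e)).1 hz c (Finset.mem_univ c)
  exact mul_self_eq_zero.1 ((Finset.sum_eq_zero_iff_of_nonneg fun e _ =>
    mul_self_nonneg (T a c e)).1 hc e (Finset.mem_univ e))

/-- The tangent inequality for the convex function `sharpQuartic`. -/
theorem sharpDeriv_le (U T : Fin p → Fin q → Fin r → ℝ) :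
    sharpDeriv U T ≤ sharpQuartic T + 3 * sharpQuartic U := by
  have h := sharpQuartic_add U (T + (-1 : ℝ) • U)
  rw [sharpDeriv_add, sharpDeriv_smul, sharpDeriv_self] at h
  have hT : U + (T + (-1 : ℝ) • U) = T := by
    rw [neg_one_smul]; abel
  rw [hT] at h
  linarith [sharpHess_nonneg (U + (1 / 3 : ℝ) • (T + (-1 : ℝ) • U)) (T + (-1 : ℝ) • U),
    sharpQuartic_nonneg (T + (-1 : ℝ) • U)]

theorem sharpNorm_nonneg (T : Fin p → Fin q → Fin r → ℝ) : 0 ≤ sharpNorm T := by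
  rw [sharpNorm, sharpQuartic_eq]
  have := sharpQuartic_nonneg T
  positivity

theorem sharpNorm_pow_four (T : Fin p → Fin q → Fin r → ℝ) :
    sharpQuartic T = 5 * sharpNorm T ^ 4 := by
  have h : 0 ≤ sharpQuartic T / 5 := div_nonneg (sharpQuartic_nonneg T) (by norm_num)
  rw [sharpNorm, sharpQuartic_eq, ← Real.rpow_natCast, ← Real.rpow_mul h]
  norm_num
  ring

theorem sharpNorm_eq_zero_iff {T : Fin p → Fin q → Fin r → ℝ} : sharpNorm T = 0 ↔ T = 0 := by
  rw [← sharpQuartic_eq_zero_iff, sharpNorm_pow_four]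
  simp

theorem sharpNorm_smul (l : ℝ) (T : Fin p → Fin q → Fin r → ℝ) :
    sharpNorm (l • T) = |l| * sharpNorm T := by
  have h := sharpQuartic_smul l T
  rw [sharpNorm_pow_four, sharpNorm_pow_four] at h
  refine (pow_left_inj₀ (sharpNorm_nonneg _)
    (mul_nonneg (abs_nonneg l) (sharpNorm_nonneg T)) four_ne_zero).1 ?_
  rw [mul_pow, Even.pow_abs (by decide)]
  linarith

/-- A Hölder-type inequality for the derivative of `sharpQuartic`. -/
theorem sharpDeriv_le_sharpNorm (U T : Fin p → Fin q → Fin r → ℝ) :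
    sharpDeriv U T ≤ 20 * sharpNorm U ^ 3 * sharpNorm T := by
  by_cases hT : T = 0
  · have h := sharpDeriv_smul 0 U T
    rw [zero_smul, zero_mul] at h
    rw [hT, h, sharpNorm_eq_zero_iff.2 rfl, mul_zero]
  by_cases hU : U = 0
  · simp [hU, sharpNorm_eq_zero_iff.2, sharpDeriv, sharpTerm, sumSix]
  have hT' : 0 < sharpNorm T := (sharpNorm_nonneg T).lt_of_ne' (mt sharpNorm_eq_zero_iff.1 hT)
  have hU' : 0 < sharpNorm U := (sharpNorm_nonneg U).lt_of_ne' (mt sharpNorm_eq_zero_iff.1 hU)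
  have h := sharpDeriv_le U ((sharpNorm U / sharpNorm T) • T)
  rw [sharpDeriv_smul, sharpQuartic_smul, sharpNorm_pow_four, sharpNorm_pow_four] at h
  have h' : sharpNorm U / sharpNorm T * sharpDeriv U T ≤
      sharpNorm U / sharpNorm T * (20 * sharpNorm U ^ 3 * sharpNorm T) := by
    refine h.trans_eq ?_
    field_simp
    ring
  exact le_of_mul_le_mul_left h' (div_pos hU' hT')

theorem sharpNorm_add_le (T S : Fin p → Fin q → Fin r → ℝ) :
    sharpNorm (T + S) ≤ sharpNorm T + sharpNorm S := by
  rcases (sharpNorm_nonneg (T + S)).eq_or_lt with h | h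
  · rw [← h]
    exact add_nonneg (sharpNorm_nonneg T) (sharpNorm_nonneg S)
  have hd := sharpDeriv_self (T + S)
  rw [sharpDeriv_add, sharpNorm_pow_four] at hd
  have hT := sharpDeriv_le_sharpNorm (T + S) T
  have hS := sharpDeriv_le_sharpNorm (T + S) S
  refine le_of_mul_le_mul_left ?_ (pow_pos h 3)
  linarith

end SharpForm

theorem stmt_12 (p q r : ℕ) (hp : 1 ≤ p) (hq : 1 ≤ q) (hr : 1 ≤ r) :
    (∀ T : Fin p → Fin q → Fin r → ℝ, 0 ≤ P₁ T + P₂ T + P₃ T + 2 * P₄ T) ∧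
    (∀ T : Fin p → Fin q → Fin r → ℝ, sharpNorm T = 0 ↔ T = 0) ∧
    (∀ (l : ℝ) (T : Fin p → Fin q → Fin r → ℝ), sharpNorm (l • T) = |l| * sharpNorm T) ∧
    (∀ T S : Fin p → Fin q → Fin r → ℝ, sharpNorm (T + S) ≤ sharpNorm T + sharpNorm S) := by
  exact ⟨fun T => (sharpQuartic_eq T).symm ▸ sharpQuartic_nonneg T,
    fun _ => sharpNorm_eq_zero_iff, sharpNorm_smul, sharpNorm_add_le⟩
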